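/- Let Y = [0,T]×ℝ^d×P(ℝ^d). For Borel b : Y → ℝ^d and a : Y → Sym₊(ℝ^{d×d}), the set KFP(b,a) of curves μ = (μ_t) ∈ C([0,T],P(ℝ^d)) such that ∫_0^T∫ [|b_t(x,μ_t)|/(1+|x|) + |a_t(x,μ_t)|/(1+|x|²)] dμ_t dt < ∞ and ∂_t μ_t = (L^μ_{b_t,a_t})*μ_t holds distributionally, is a Borel subset of C([0,T],P(ℝ^d)) with the compact-open topology (P(ℝ^d) carrying the narrow topology). -/

import Mathlib

open MeasureTheory Set
open scoped ENNReal RealInnerProductSpace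

noncomputable section

abbrev Ed (d : ℕ) := EuclideanSpace ℝ (Fin d)

/-- `P(ℝ^d)` with the narrow topology. -/
abbrev Pm (d : ℕ) := ProbabilityMeasure (Ed d)

instance (d : ℕ) : MeasurableSpace (Pm d) := borel _

/-- `C([0,T],P(ℝ^d))` with the compact-open topology. -/
abbrev CurveSp (T : ℝ) (d : ℕ) := C(Set.Icc (0:ℝ) T, Pm d)

instance (T : ℝ) (d : ℕ) : MeasurableSpace (CurveSp T d) := borel _

/-- `ξ ∈ C_c^1((0,T))`. -/
def IsTestXi (T : ℝ) (ξ : ℝ → ℝ) : Prop :=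
  ContDiff ℝ 1 ξ ∧ HasCompactSupport ξ ∧ Function.support ξ ⊆ Set.Ioo 0 T

/-- `φ ∈ C_c^2(ℝ^d)`. -/
def IsTestPhi {d : ℕ} (φ : Ed d → ℝ) : Prop :=
  ContDiff ℝ 2 φ ∧ HasCompactSupport φ

/-- `L^μ_{b_t,a_t}φ(x)`. -/
def Lop {d : ℕ} (b : ℝ → Ed d → Pm d → Ed d)
    (a : ℝ → Ed d → Pm d → (Ed d →L[ℝ] Ed d))
    (μ : Pm d) (t : ℝ) (φ : Ed d → ℝ) (x : Ed d) : ℝ :=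
  ⟪b t x μ, gradient φ x⟫ +
    (1/2) * LinearMap.trace ℝ (Ed d) ((a t x μ ∘L fderiv ℝ (gradient φ) x).toLinearMap)

/-- `L_Φ(μ) = (∫φ_1 dμ, …, ∫φ_k dμ)`. -/
def LPhi {d k : ℕ} (Φ : Fin k → Ed d → ℝ) (μ : Pm d) : Fin k → ℝ :=
  fun i => ∫ x, Φ i x ∂(μ : Measure (Ed d))

/-- The operator `K_{b_t,a_t}` on the cylinder function `F = Ψ ∘ L_Φ`. -/
def Kba {d k : ℕ} (b : ℝ → Ed d → Pm d → Ed d)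
    (a : ℝ → Ed d → Pm d → (Ed d →L[ℝ] Ed d)) (t : ℝ)
    (Ψ : (Fin k → ℝ) → ℝ) (Φ : Fin k → Ed d → ℝ)
    (x : Ed d) (μ : Pm d) : ℝ :=
  ∑ i, fderiv ℝ Ψ (LPhi Φ μ) (Pi.single i 1) * Lop b a μ t (Φ i) x

/-- The weighted integrand `|b|/(1+|x|) + |a|/(1+|x|²)`. -/
def wInt {d : ℕ} (b : ℝ → Ed d → Pm d → Ed d)
    (a : ℝ → Ed d → Pm d → (Ed d →L[ℝ] Ed d)) (t : ℝ) (x : Ed d) (μ : Pm d) : ℝ :=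
  ‖b t x μ‖ / (1 + ‖x‖) + ‖a t x μ‖ / (1 + ‖x‖ ^ 2)

/-- `c ∈ KFP(b,a)` for a continuous curve `c : [0,T] → P(ℝ^d)`: weighted integrability
and the distributional Kolmogorov–Fokker–Planck equation. -/
def KFPmem {T : ℝ} {d : ℕ} (hT : 0 ≤ T) (b : ℝ → Ed d → Pm d → Ed d)
    (a : ℝ → Ed d → Pm d → (Ed d →L[ℝ] Ed d)) (c : CurveSp T d) : Prop :=
  (∫⁻ t in Set.Icc (0:ℝ) T, ∫⁻ x,
      ENNReal.ofReal (wInt b a t x (c (Set.projIcc 0 T hT t)))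
      ∂(c (Set.projIcc 0 T hT t) : Measure (Ed d)) ∂volume) < ∞ ∧
  ∀ ξ φ, IsTestXi T ξ → IsTestPhi (d := d) φ →
    ∫ t in (0:ℝ)..T, deriv ξ t *
        ∫ x, φ x ∂(c (Set.projIcc 0 T hT t) : Measure (Ed d)) =
      - ∫ t in (0:ℝ)..T, ξ t *
          ∫ x, Lop b a (c (Set.projIcc 0 T hT t)) t φ x
            ∂(c (Set.projIcc 0 T hT t) : Measure (Ed d))

open Filter Topology ProbabilityTheory

instance (d : ℕ) : BorelSpace (Pm d) := ⟨rfl⟩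

instance (T : ℝ) (d : ℕ) : BorelSpace (CurveSp T d) := ⟨rfl⟩

/-- The Borel σ-algebra of the narrow topology makes all evaluations `μ ↦ μ s` measurable. -/
lemma measurable_Pm_toMeasure (d : ℕ) : Measurable fun μ : Pm d => (μ : Measure (Ed d)) := by
  refine Measurable.measure_of_isPiSystem_of_isProbabilityMeasure
    (BorelSpace.measurable_eq.trans borel_eq_generateFrom_isClosed) isPiSystem_isClosed ?_
  intro F hF
  have hF' : IsClosed F := hF
  exact ENNReal.measurable_of_tendsto
    (fun n => (ProbabilityMeasure.continuous_lintegral_boundedContinuousFunction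
      (hF'.apprSeq n)).measurable)
    (tendsto_pi_nhds.2 fun μ => HasOuterApproxClosed.tendsto_lintegral_apprSeq hF' (μ : Measure (Ed d)))

lemma measurable_curve_eval {T : ℝ} {d : ℕ} (hT : 0 ≤ T) :
    Measurable fun p : ℝ × CurveSp T d => p.2 (projIcc 0 T hT p.1) := by
  have : Continuous fun p : ℝ × CurveSp T d => p.2 (projIcc 0 T hT p.1) :=
    continuous_snd.eval (continuous_projIcc.comp continuous_fst)
  exact this.measurable

/-- The Markov kernel `(t, c) ↦ c_t`. -/
def evalKernel {T : ℝ} (d : ℕ) (hT : 0 ≤ T) : Kernel (ℝ × CurveSp T d) (Ed d) where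
  toFun p := (p.2 (projIcc 0 T hT p.1) : Measure (Ed d))
  measurable' := (measurable_Pm_toMeasure d).comp (measurable_curve_eval hT)

instance {T : ℝ} (d : ℕ) (hT : 0 ≤ T) : IsMarkovKernel (evalKernel d hT) :=
  ⟨fun p => inferInstanceAs (IsProbabilityMeasure (p.2 (projIcc 0 T hT p.1) : Measure (Ed d)))⟩

/-- The Markov kernel `t ↦ c_t` of a fixed curve. -/
def curveKernel {T : ℝ} {d : ℕ} (hT : 0 ≤ T) (c : CurveSp T d) : Kernel ℝ (Ed d) :=
  (evalKernel d hT).comap (fun t => (t, c)) measurable_prodMk_right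

instance {T : ℝ} {d : ℕ} (hT : 0 ≤ T) (c : CurveSp T d) : IsMarkovKernel (curveKernel hT c) := by
  unfold curveKernel; infer_instance

/-- The measure `dc_t(x) dt` on `(0,T] × ℝ^d`. -/
def curveMeasure {T : ℝ} {d : ℕ} (hT : 0 ≤ T) (c : CurveSp T d) : Measure (ℝ × Ed d) :=
  (volume.restrict (Ioc 0 T)).compProd (curveKernel hT c)

instance {T : ℝ} {d : ℕ} (hT : 0 ≤ T) (c : CurveSp T d) : IsFiniteMeasure (curveMeasure hT c) := by
  unfold curveMeasure; infer_instance

lemma ae_curveMeasure_mem {T : ℝ} {d : ℕ} (hT : 0 ≤ T) (c : CurveSp T d) :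
    ∀ᵐ z ∂curveMeasure hT c, z.1 ∈ Icc 0 T := by
  refine Measure.ae_compProd_of_ae_ae (measurableSet_Icc.preimage measurable_fst) ?_
  filter_upwards [ae_restrict_mem measurableSet_Ioc] with t ht
  exact Eventually.of_forall fun _ => Ioc_subset_Icc_self ht

lemma integral_mul_integral_curve {T : ℝ} {d : ℕ} (hT : 0 ≤ T) (c : CurveSp T d)
    (g : ℝ → ℝ) (h : ℝ → Ed d → ℝ)
    (hi : Integrable (fun z : ℝ × Ed d => g z.1 * h z.1 z.2) (curveMeasure hT c)) :
    ∫ t in (0:ℝ)..T, g t * ∫ x, h t x ∂(c (projIcc 0 T hT t) : Measure (Ed d)) =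
      ∫ z, g z.1 * h z.1 z.2 ∂curveMeasure hT c := by
  rw [intervalIntegral.integral_of_le hT]
  unfold curveMeasure at hi ⊢
  rw [Measure.integral_compProd hi]
  refine integral_congr_ae (Eventually.of_forall fun t => ?_)
  exact (integral_const_mul _ _).symm

lemma contDiff_gradient {d : ℕ} {φ : Ed d → ℝ} (h : ContDiff ℝ 2 φ) :
    ContDiff ℝ 1 (gradient φ) :=
  (InnerProductSpace.toDual ℝ (Ed d)).symm.contDiff.comp (h.fderiv_right (by norm_num))

lemma tsupport_gradient_subset {d : ℕ} (φ : Ed d → ℝ) : tsupport (gradient φ) ⊆ tsupport φ := by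
  refine (closure_mono fun x hx => ?_).trans (tsupport_fderiv_subset ℝ (f := φ))
  simpa [gradient] using hx

/-- The trace as a continuous linear functional on endomorphisms. -/
def traceL (d : ℕ) : (Ed d →L[ℝ] Ed d) →L[ℝ] ℝ :=
  LinearMap.toContinuousLinearMap
    (LinearMap.trace ℝ (Ed d) ∘ₗ ContinuousLinearMap.coeLM ℝ)

lemma Lop_eq {d : ℕ} (b : ℝ → Ed d → Pm d → Ed d) (a : ℝ → Ed d → Pm d → (Ed d →L[ℝ] Ed d))
    (μ : Pm d) (t : ℝ) (φ : Ed d → ℝ) (x : Ed d) :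
    Lop b a μ t φ x = ⟪b t x μ, gradient φ x⟫ +
      (1/2) * traceL d (a t x μ ∘L fderiv ℝ (gradient φ) x) := rfl

section Coefficients

variable {T : ℝ} {d : ℕ} (hT : 0 ≤ T) {b : ℝ → Ed d → Pm d → Ed d}
  {a : ℝ → Ed d → Pm d → (Ed d →L[ℝ] Ed d)}

lemma measurable_Lop
    (hb : Measurable fun p : ℝ × Ed d × Pm d => b p.1 p.2.1 p.2.2)
    (ha : Measurable fun p : ℝ × Ed d × Pm d => a p.1 p.2.1 p.2.2)
    {φ : Ed d → ℝ} (hφ : ContDiff ℝ 2 φ) :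
    Measurable fun p : ℝ × Ed d × Pm d => Lop b a p.2.2 p.1 φ p.2.1 := by
  have hg := contDiff_gradient hφ
  have hD : Continuous (fderiv ℝ (gradient φ)) := hg.continuous_fderiv (by norm_num)
  simp only [Lop_eq]
  refine (hb.inner (hg.continuous.measurable.comp measurable_snd.fst)).add (.const_mul ?_ _)
  have hc : Continuous fun q : (Ed d →L[ℝ] Ed d) × (Ed d →L[ℝ] Ed d) => traceL d (q.1 ∘L q.2) := by
    fun_prop
  exact hc.measurable.comp (ha.prodMk (hD.measurable.comp measurable_snd.fst))

lemma measurable_wInt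
    (hb : Measurable fun p : ℝ × Ed d × Pm d => b p.1 p.2.1 p.2.2)
    (ha : Measurable fun p : ℝ × Ed d × Pm d => a p.1 p.2.1 p.2.2) :
    Measurable fun p : ℝ × Ed d × Pm d => wInt b a p.1 p.2.1 p.2.2 := by
  have hx : Measurable fun p : ℝ × Ed d × Pm d => p.2.1 := measurable_snd.fst
  exact (hb.norm.div (hx.norm.const_add 1)).add (ha.norm.div ((hx.norm.pow_const 2).const_add 1))

lemma wInt_nonneg (t : ℝ) (x : Ed d) (μ : Pm d) : 0 ≤ wInt b a t x μ := by
  unfold wInt; positivity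

lemma abs_Lop_le {C : ℝ} (μ : Pm d) (t : ℝ) {φ : Ed d → ℝ} (x : Ed d)
    (h1 : ‖gradient φ x‖ * (1 + ‖x‖) ≤ C)
    (h2 : ‖fderiv ℝ (gradient φ) x‖ * (1 + ‖x‖ ^ 2) ≤ C) :
    |Lop b a μ t φ x| ≤ (1 + ‖traceL d‖) * C * wInt b a t x μ := by
  have hC : 0 ≤ C := le_trans (by positivity) h1
  have e1 : |⟪b t x μ, gradient φ x⟫| ≤ C * (‖b t x μ‖ / (1 + ‖x‖)) :=
    calc |⟪b t x μ, gradient φ x⟫| ≤ ‖b t x μ‖ * ‖gradient φ x‖ := abs_real_inner_le_norm _ _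
      _ = (‖gradient φ x‖ * (1 + ‖x‖)) * (‖b t x μ‖ / (1 + ‖x‖)) := by
        have : 1 + ‖x‖ ≠ 0 := by positivity
        field_simp
      _ ≤ _ := by gcongr
  have e2 : |traceL d (a t x μ ∘L fderiv ℝ (gradient φ) x)| ≤
      ‖traceL d‖ * (C * (‖a t x μ‖ / (1 + ‖x‖ ^ 2))) :=
    calc |traceL d (a t x μ ∘L fderiv ℝ (gradient φ) x)|
        ≤ ‖traceL d‖ * ‖a t x μ ∘L fderiv ℝ (gradient φ) x‖ := (traceL d).le_opNorm _
      _ ≤ ‖traceL d‖ * (‖a t x μ‖ * ‖fderiv ℝ (gradient φ) x‖) := by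
        gcongr; exact ContinuousLinearMap.opNorm_comp_le _ _
      _ = ‖traceL d‖ * ((‖fderiv ℝ (gradient φ) x‖ * (1 + ‖x‖ ^ 2)) *
          (‖a t x μ‖ / (1 + ‖x‖ ^ 2))) := by
        have : 1 + ‖x‖ ^ 2 ≠ 0 := by positivity
        field_simp
      _ ≤ _ := by gcongr
  rw [Lop_eq]
  refine (abs_add_le _ _).trans ?_
  rw [abs_mul, abs_of_pos (by norm_num : (0:ℝ) < 1 / 2)]
  unfold wInt
  have p1 : 0 ≤ C * (‖b t x μ‖ / (1 + ‖x‖)) := by positivity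
  have p2 : 0 ≤ C * (‖a t x μ‖ / (1 + ‖x‖ ^ 2)) := by positivity
  have p3 : 0 ≤ ‖traceL d‖ := ContinuousLinearMap.opNorm_nonneg _
  nlinarith [mul_nonneg p3 p1, mul_nonneg p3 p2]

/-- The weighted integrability condition on a curve. -/
def FiniteWeight (b : ℝ → Ed d → Pm d → Ed d) (a : ℝ → Ed d → Pm d → (Ed d →L[ℝ] Ed d))
    (c : CurveSp T d) : Prop :=
  (∫⁻ t in Icc (0:ℝ) T, ∫⁻ x, ENNReal.ofReal (wInt b a t x (c (projIcc 0 T hT t)))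
      ∂(c (projIcc 0 T hT t) : Measure (Ed d)) ∂volume) < ∞

/-- The Kolmogorov–Fokker–Planck equation tested against `ξ ⊗ φ`. -/
def SolvesTested (b : ℝ → Ed d → Pm d → Ed d) (a : ℝ → Ed d → Pm d → (Ed d →L[ℝ] Ed d))
    (ξ : ℝ → ℝ) (φ : Ed d → ℝ) (c : CurveSp T d) : Prop :=
  ∫ t in (0:ℝ)..T, deriv ξ t * ∫ x, φ x ∂(c (projIcc 0 T hT t) : Measure (Ed d)) =
    - ∫ t in (0:ℝ)..T, ξ t * ∫ x, Lop b a (c (projIcc 0 T hT t)) t φ x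
        ∂(c (projIcc 0 T hT t) : Measure (Ed d))

lemma measurable_along_curves {β : Type*} [MeasurableSpace β] {g : ℝ × Ed d × Pm d → β}
    (hg : Measurable g) :
    Measurable fun q : (ℝ × CurveSp T d) × Ed d =>
      g (q.1.1, q.2, q.1.2 (projIcc 0 T hT q.1.1)) :=
  hg.comp (measurable_fst.fst.prodMk
    (measurable_snd.prodMk ((measurable_curve_eval hT).comp measurable_fst)))

lemma measurable_along_curve {β : Type*} [MeasurableSpace β] {g : ℝ × Ed d × Pm d → β}
    (hg : Measurable g) (c : CurveSp T d) :
    Measurable fun z : ℝ × Ed d => g (z.1, z.2, c (projIcc 0 T hT z.1)) :=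
  hg.comp (measurable_fst.prodMk (measurable_snd.prodMk
    ((c.continuous.comp continuous_projIcc).measurable.comp measurable_fst)))

lemma measurable_integral_curve {g : ℝ × Ed d × Pm d → ℝ} (hg : Measurable g) {ζ : ℝ → ℝ}
    (hζ : Measurable ζ) :
    Measurable fun c : CurveSp T d => ∫ t in (0:ℝ)..T, ζ t *
      ∫ x, g (t, x, c (projIcc 0 T hT t)) ∂(c (projIcc 0 T hT t) : Measure (Ed d)) := by
  simp only [intervalIntegral.integral_of_le hT]
  have h1 := ((measurable_along_curves hT hg).stronglyMeasurable).integral_kernel_prod_right'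
    (κ := evalKernel d hT)
  have h2 : StronglyMeasurable fun p : ℝ × CurveSp T d => ζ p.1 *
      ∫ x, g (p.1, x, p.2 (projIcc 0 T hT p.1)) ∂(p.2 (projIcc 0 T hT p.1) : Measure (Ed d)) :=
    (hζ.comp measurable_fst).stronglyMeasurable.mul h1
  exact (h2.integral_prod_left' (μ := volume.restrict (Ioc 0 T))).measurable

lemma measurableSet_finiteWeight
    (hb : Measurable fun p : ℝ × Ed d × Pm d => b p.1 p.2.1 p.2.2)
    (ha : Measurable fun p : ℝ × Ed d × Pm d => a p.1 p.2.1 p.2.2) :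
    MeasurableSet {c : CurveSp T d | FiniteWeight hT b a c} := by
  have h1 := (measurable_along_curves hT (measurable_wInt hb ha).ennreal_ofReal
    ).lintegral_kernel_prod_right' (κ := evalKernel d hT)
  exact measurableSet_lt (h1.lintegral_prod_left' (μ := volume.restrict (Icc 0 T)))
    measurable_const

lemma measurableSet_solvesTested
    (hb : Measurable fun p : ℝ × Ed d × Pm d => b p.1 p.2.1 p.2.2)
    (ha : Measurable fun p : ℝ × Ed d × Pm d => a p.1 p.2.1 p.2.2)
    {ξ : ℝ → ℝ} {φ : Ed d → ℝ} (hξ : IsTestXi T ξ) (hφ : IsTestPhi φ) :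
    MeasurableSet {c : CurveSp T d | SolvesTested hT b a ξ φ c} :=
  measurableSet_eq_fun
    (measurable_integral_curve hT (hφ.1.continuous.measurable.comp measurable_snd.fst)
      (measurable_deriv ξ))
    (measurable_integral_curve hT (measurable_Lop hb ha hφ.1) hξ.1.continuous.measurable).neg

lemma FiniteWeight.integrable {c : CurveSp T d}
    (hb : Measurable fun p : ℝ × Ed d × Pm d => b p.1 p.2.1 p.2.2)
    (ha : Measurable fun p : ℝ × Ed d × Pm d => a p.1 p.2.1 p.2.2)
    (h : FiniteWeight hT b a c) :
    Integrable (fun z : ℝ × Ed d => wInt b a z.1 z.2 (c (projIcc 0 T hT z.1)))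
      (curveMeasure hT c) := by
  have hm : Measurable fun z : ℝ × Ed d => wInt b a z.1 z.2 (c (projIcc 0 T hT z.1)) :=
    measurable_along_curve hT (measurable_wInt hb ha) c
  refine ⟨hm.aestronglyMeasurable, ?_⟩
  rw [hasFiniteIntegral_iff_ofReal (Eventually.of_forall fun z => wInt_nonneg _ _ _)]
  unfold curveMeasure
  rw [Measure.lintegral_compProd hm.ennreal_ofReal, restrict_Ioc_eq_restrict_Icc]
  exact h

/-- Regularity and weighted `C`-bounds of a pair of test functions on `[0,T] × ℝ^d`. -/
structure TestBound (T C : ℝ) (ξ : ℝ → ℝ) (φ : Ed d → ℝ) : Prop where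
  contDiff_time : ContDiff ℝ 1 ξ
  contDiff_space : ContDiff ℝ 2 φ
  time : ∀ t ∈ Icc 0 T, |ξ t| ≤ C
  deriv_time : ∀ t ∈ Icc 0 T, |deriv ξ t| ≤ C
  space : ∀ x, |φ x| ≤ C
  gradient_space : ∀ x, ‖gradient φ x‖ * (1 + ‖x‖) ≤ C
  hessian_space : ∀ x, ‖fderiv ℝ (gradient φ) x‖ * (1 + ‖x‖ ^ 2) ≤ C

lemma TestBound.nonneg {C : ℝ} {ξ : ℝ → ℝ} {φ : Ed d → ℝ} (h : TestBound T C ξ φ) : 0 ≤ C :=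
  (abs_nonneg _).trans (h.space 0)

lemma TestBound.ae_abs_left_le {C : ℝ} {ξ : ℝ → ℝ} {φ : Ed d → ℝ} (h : TestBound T C ξ φ)
    (c : CurveSp T d) : ∀ᵐ z ∂curveMeasure hT c, ‖deriv ξ z.1 * φ z.2‖ ≤ C * C := by
  filter_upwards [ae_curveMeasure_mem hT c] with z hz
  rw [norm_mul]
  exact mul_le_mul (h.deriv_time _ hz) (h.space _) (norm_nonneg _) h.nonneg

lemma TestBound.ae_abs_right_le {C : ℝ} {ξ : ℝ → ℝ} {φ : Ed d → ℝ} (h : TestBound T C ξ φ)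
    (c : CurveSp T d) : ∀ᵐ z ∂curveMeasure hT c,
      ‖ξ z.1 * Lop b a (c (projIcc 0 T hT z.1)) z.1 φ z.2‖ ≤
        C * ((1 + ‖traceL d‖) * C * wInt b a z.1 z.2 (c (projIcc 0 T hT z.1))) := by
  filter_upwards [ae_curveMeasure_mem hT c] with z hz
  rw [norm_mul]
  exact mul_le_mul (h.time _ hz) (abs_Lop_le _ _ _ (h.gradient_space _) (h.hessian_space _))
    (norm_nonneg _) h.nonneg

lemma TestBound.aestronglyMeasurable_left {C : ℝ} {ξ : ℝ → ℝ} {φ : Ed d → ℝ}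
    (h : TestBound T C ξ φ) (c : CurveSp T d) :
    AEStronglyMeasurable (fun z : ℝ × Ed d => deriv ξ z.1 * φ z.2) (curveMeasure hT c) :=
  (((measurable_deriv ξ).comp measurable_fst).mul
    (h.contDiff_space.continuous.measurable.comp measurable_snd)).aestronglyMeasurable

lemma TestBound.aestronglyMeasurable_right {C : ℝ} {ξ : ℝ → ℝ} {φ : Ed d → ℝ}
    (hb : Measurable fun p : ℝ × Ed d × Pm d => b p.1 p.2.1 p.2.2)
    (ha : Measurable fun p : ℝ × Ed d × Pm d => a p.1 p.2.1 p.2.2)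
    (h : TestBound T C ξ φ) (c : CurveSp T d) :
    AEStronglyMeasurable
      (fun z : ℝ × Ed d => ξ z.1 * Lop b a (c (projIcc 0 T hT z.1)) z.1 φ z.2)
      (curveMeasure hT c) :=
  ((h.contDiff_time.continuous.measurable.comp measurable_fst).mul
    (measurable_along_curve hT (measurable_Lop hb ha h.contDiff_space) c)).aestronglyMeasurable

lemma TestBound.solvesTested_iff {C : ℝ} {ξ : ℝ → ℝ} {φ : Ed d → ℝ}
    (hb : Measurable fun p : ℝ × Ed d × Pm d => b p.1 p.2.1 p.2.2)
    (ha : Measurable fun p : ℝ × Ed d × Pm d => a p.1 p.2.1 p.2.2)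
    (h : TestBound T C ξ φ) {c : CurveSp T d} (hc : FiniteWeight hT b a c) :
    SolvesTested hT b a ξ φ c ↔
      ∫ z, deriv ξ z.1 * φ z.2 ∂curveMeasure hT c =
        - ∫ z, ξ z.1 * Lop b a (c (projIcc 0 T hT z.1)) z.1 φ z.2 ∂curveMeasure hT c := by
  unfold SolvesTested
  rw [integral_mul_integral_curve hT c (deriv ξ) (fun _ => φ)
      ((integrable_const (C * C)).mono' (h.aestronglyMeasurable_left hT c)
        (h.ae_abs_left_le hT c)),
    integral_mul_integral_curve hT c ξ (fun t => Lop b a (c (projIcc 0 T hT t)) t φ)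
      ((((hc.integrable hT hb ha).const_mul _).const_mul _).mono'
        (h.aestronglyMeasurable_right hT hb ha c) (h.ae_abs_right_le hT c))]

/-- Stability of the tested equation under bounded pointwise convergence of test functions. -/
lemma SolvesTested.of_tendsto {C : ℝ} {ξ : ℝ → ℝ} {φ : Ed d → ℝ} {u : ℕ → ℝ → ℝ}
    {v : ℕ → Ed d → ℝ}
    (hb : Measurable fun p : ℝ × Ed d × Pm d => b p.1 p.2.1 p.2.2)
    (ha : Measurable fun p : ℝ × Ed d × Pm d => a p.1 p.2.1 p.2.2)
    {c : CurveSp T d} (hc : FiniteWeight hT b a c)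
    (h : TestBound T C ξ φ) (hk : ∀ k, TestBound T C (u k) (v k))
    (h1 : ∀ t ∈ Icc 0 T, Tendsto (fun k => u k t) atTop (𝓝 (ξ t)))
    (h2 : ∀ t ∈ Icc 0 T, Tendsto (fun k => deriv (u k) t) atTop (𝓝 (deriv ξ t)))
    (h3 : ∀ x, Tendsto (fun k => v k x) atTop (𝓝 (φ x)))
    (h4 : ∀ x, Tendsto (fun k => gradient (v k) x) atTop (𝓝 (gradient φ x)))
    (h5 : ∀ x, Tendsto (fun k => fderiv ℝ (gradient (v k)) x) atTop
      (𝓝 (fderiv ℝ (gradient φ) x)))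
    (hs : ∀ k, SolvesTested hT b a (u k) (v k) c) : SolvesTested hT b a ξ φ c := by
  rw [h.solvesTested_iff hT hb ha hc]
  have l1 : Tendsto (fun k => ∫ z, deriv (u k) z.1 * v k z.2 ∂curveMeasure hT c) atTop
      (𝓝 (∫ z, deriv ξ z.1 * φ z.2 ∂curveMeasure hT c)) := by
    refine tendsto_integral_of_dominated_convergence (fun _ => C * C)
      (fun k => (hk k).aestronglyMeasurable_left hT c) (integrable_const _)
      (fun k => (hk k).ae_abs_left_le hT c) ?_
    filter_upwards [ae_curveMeasure_mem hT c] with z hz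
    exact (h2 _ hz).mul (h3 _)
  have l2 : Tendsto (fun k => ∫ z, u k z.1 * Lop b a (c (projIcc 0 T hT z.1)) z.1 (v k) z.2
      ∂curveMeasure hT c) atTop
      (𝓝 (∫ z, ξ z.1 * Lop b a (c (projIcc 0 T hT z.1)) z.1 φ z.2 ∂curveMeasure hT c)) := by
    refine tendsto_integral_of_dominated_convergence _
      (fun k => (hk k).aestronglyMeasurable_right hT hb ha c)
      (((hc.integrable hT hb ha).const_mul _).const_mul _)
      (fun k => (hk k).ae_abs_right_le hT c) ?_
    filter_upwards [ae_curveMeasure_mem hT c] with z hz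
    refine (h1 _ hz).mul ?_
    simp only [Lop_eq]
    refine (tendsto_const_nhds.inner (h4 _)).add (.const_mul _ ?_)
    exact ((traceL d).continuous.tendsto _).comp
      (((continuous_const.clm_comp continuous_id).tendsto _).comp (h5 _))
  refine tendsto_nhds_unique l1 (l2.neg.congr fun k => ?_)
  exact (((hk k).solvesTested_iff hT hb ha hc).1 (hs k)).symm

end Coefficients

/-- Any map into a second countable space has a countable set of arguments through which every
value can be approximated sequentially. -/
lemma exists_countable_forall_tendsto {α X : Type*} [TopologicalSpace X]
    [SecondCountableTopology X] (f : α → X) :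
    ∃ D : Set α, D.Countable ∧ ∀ x, ∃ u : ℕ → α, (∀ k, u k ∈ D) ∧
      Tendsto (fun k => f (u k)) atTop (𝓝 (f x)) := by
  let _ : TopologicalSpace α := .induced f inferInstance
  have hf : IsInducing f := ⟨rfl⟩
  have : SecondCountableTopology α := hf.secondCountableTopology
  obtain ⟨D, hD, hD'⟩ := TopologicalSpace.exists_countable_dense α
  refine ⟨D, hD, fun x => ?_⟩
  obtain ⟨u, hu, hux⟩ := mem_closure_iff_seq_limit.1 (hD' x)
  exact ⟨u, hu, (hf.continuous.tendsto x).comp hux⟩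

/-- Pairs of test functions whose spatial part is supported in the ball of radius `n`. -/
abbrev TestPair (T : ℝ) (d n : ℕ) :=
  {p : (ℝ → ℝ) × (Ed d → ℝ) //
    IsTestXi T p.1 ∧ IsTestPhi p.2 ∧ tsupport p.2 ⊆ Metric.closedBall 0 n}

/-- The time part of a test pair and its derivative on `[0,T]`. -/
def timeJet {T : ℝ} {d n : ℕ} (p : TestPair T d n) : C(Icc (0:ℝ) T, ℝ × ℝ) where
  toFun t := (p.1.1 t, deriv p.1.1 t)
  continuous_toFun := (p.2.1.1.continuous.comp continuous_subtype_val).prodMk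
    ((p.2.1.1.continuous_deriv le_rfl).comp continuous_subtype_val)

/-- The spatial part of a test pair, its gradient and its Hessian on the ball of radius `n`. -/
def spaceJet {T : ℝ} {d n : ℕ} (p : TestPair T d n) :
    C(Metric.closedBall (0 : Ed d) n, ℝ × Ed d × (Ed d →L[ℝ] Ed d)) where
  toFun x := (p.1.2 x, gradient p.1.2 x, fderiv ℝ (gradient p.1.2) x)
  continuous_toFun := by
    have hg := contDiff_gradient p.2.2.1.1
    exact (p.2.2.1.1.continuous.prodMk (hg.continuous.prodMk
      (hg.continuous_fderiv one_ne_zero))).comp continuous_subtype_val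

lemma TestPair.eq_zero {T : ℝ} {d n : ℕ} (p : TestPair T d n) {x : Ed d}
    (hx : x ∉ Metric.closedBall 0 (n : ℝ)) :
    p.1.2 x = 0 ∧ gradient p.1.2 x = 0 ∧ fderiv ℝ (gradient p.1.2) x = 0 := by
  have h1 : x ∉ tsupport p.1.2 := fun h => hx (p.2.2.2 h)
  have h2 : x ∉ tsupport (gradient p.1.2) := fun h => h1 (tsupport_gradient_subset _ h)
  exact ⟨image_eq_zero_of_notMem_tsupport h1, image_eq_zero_of_notMem_tsupport h2,
    image_eq_zero_of_notMem_tsupport fun h => h2 (tsupport_fderiv_subset ℝ h)⟩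

lemma TestPair.testBound {T : ℝ} {d n : ℕ} (p : TestPair T d n) {R : ℝ}
    (h1 : ‖timeJet p‖ ≤ R) (h2 : ‖spaceJet p‖ ≤ R) :
    TestBound T (R * (1 + (n : ℝ)) ^ 2) p.1.1 p.1.2 := by
  have hR : 0 ≤ R := (norm_nonneg _).trans h1
  have hn : (0:ℝ) ≤ n := n.cast_nonneg
  have hone : R ≤ R * (1 + (n : ℝ)) ^ 2 := le_mul_of_one_le_right hR (by nlinarith)
  have ht (t : ℝ) (h : t ∈ Icc 0 T) : ‖(p.1.1 t, deriv p.1.1 t)‖ ≤ R :=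
    ((timeJet p).norm_coe_le_norm ⟨t, h⟩).trans h1
  have hx (x : Ed d) (h : x ∈ Metric.closedBall (0 : Ed d) n) :
      ‖(p.1.2 x, gradient p.1.2 x, fderiv ℝ (gradient p.1.2) x)‖ ≤ R :=
    ((spaceJet p).norm_coe_le_norm ⟨x, h⟩).trans h2
  refine ⟨p.2.1.1, p.2.2.1.1, fun t h => ((norm_fst_le _).trans (ht t h)).trans hone,
    fun t h => ((norm_snd_le _).trans (ht t h)).trans hone, fun x => ?_, fun x => ?_, fun x => ?_⟩
  all_goals by_cases h : x ∈ Metric.closedBall (0 : Ed d) n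
  · exact ((norm_fst_le _).trans (hx x h)).trans hone
  · rw [(p.eq_zero h).1, abs_zero]; positivity
  · refine mul_le_mul (((norm_fst_le _).trans (norm_snd_le _)).trans (hx x h)) ?_
      (by positivity) hR
    nlinarith [mem_closedBall_zero_iff.1 h]
  · rw [(p.eq_zero h).2.1, norm_zero, zero_mul]; positivity
  · refine mul_le_mul (((norm_snd_le _).trans (norm_snd_le _)).trans (hx x h)) ?_
      (by positivity) hR
    nlinarith [mem_closedBall_zero_iff.1 h, norm_nonneg x]
  · rw [(p.eq_zero h).2.2, norm_zero, zero_mul]; positivity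

/-- Countably many test pairs suffice to test the equation. -/
lemma exists_countable_testPair {T : ℝ} {d : ℕ} (hT : 0 ≤ T) (n : ℕ)
    {b : ℝ → Ed d → Pm d → Ed d} {a : ℝ → Ed d → Pm d → (Ed d →L[ℝ] Ed d)}
    (hb : Measurable fun p : ℝ × Ed d × Pm d => b p.1 p.2.1 p.2.2)
    (ha : Measurable fun p : ℝ × Ed d × Pm d => a p.1 p.2.1 p.2.2) :
    ∃ D : Set (TestPair T d n), D.Countable ∧ ∀ c : CurveSp T d, FiniteWeight hT b a c →
      (∀ p ∈ D, SolvesTested hT b a p.1.1 p.1.2 c) →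
        ∀ p : TestPair T d n, SolvesTested hT b a p.1.1 p.1.2 c := by
  have : CompactSpace (Metric.closedBall (0 : Ed d) n) :=
    isCompact_iff_compactSpace.1 (isCompact_closedBall _ _)
  obtain ⟨D, hD, hD'⟩ :=
    exists_countable_forall_tendsto fun p : TestPair T d n => (timeJet p, spaceJet p)
  refine ⟨D, hD, fun c hc hs p => ?_⟩
  obtain ⟨u, huD, hu⟩ := hD' p
  have hnorm := (continuous_norm.tendsto (timeJet p, spaceJet p)).comp hu
  obtain ⟨R, hR⟩ := hnorm.bddAbove_range
  have hRk (k : ℕ) : ‖(timeJet (u k), spaceJet (u k))‖ ≤ R := hR ⟨k, rfl⟩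
  have hRp : ‖(timeJet p, spaceJet p)‖ ≤ R := le_of_tendsto' hnorm hRk
  have htime (t : ℝ) (h : t ∈ Icc 0 T) : Tendsto (fun k => ((u k).1.1 t, deriv (u k).1.1 t))
      atTop (𝓝 (p.1.1 t, deriv p.1.1 t)) :=
    ((continuous_eval_const (⟨t, h⟩ : Icc (0:ℝ) T)).tendsto _).comp hu.fst_nhds
  have hspace (x : Ed d) : Tendsto
      (fun k => ((u k).1.2 x, gradient (u k).1.2 x, fderiv ℝ (gradient (u k).1.2) x))
      atTop (𝓝 (p.1.2 x, gradient p.1.2 x, fderiv ℝ (gradient p.1.2) x)) := by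
    by_cases h : x ∈ Metric.closedBall (0 : Ed d) n
    · exact ((continuous_eval_const (⟨x, h⟩ : Metric.closedBall (0 : Ed d) n)).tendsto _).comp
        hu.snd_nhds
    · simp only [(p.eq_zero h).1, (p.eq_zero h).2.1, (p.eq_zero h).2.2,
        ((u _).eq_zero h).1, ((u _).eq_zero h).2.1, ((u _).eq_zero h).2.2]
      exact tendsto_const_nhds
  exact SolvesTested.of_tendsto hT hb ha hc
    (p.testBound ((norm_fst_le _).trans hRp) ((norm_snd_le _).trans hRp))
    (fun k => (u k).testBound ((norm_fst_le _).trans (hRk k)) ((norm_snd_le _).trans (hRk k)))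
    (fun t h => (htime t h).fst_nhds) (fun t h => (htime t h).snd_nhds)
    (fun x => (hspace x).fst_nhds) (fun x => (hspace x).snd_nhds.fst_nhds)
    (fun x => (hspace x).snd_nhds.snd_nhds) (fun k => hs _ (huD k))

/-- For Borel coefficients `b, a`, the set `KFP(b,a)` of solutions of
the non-linear Kolmogorov–Fokker–Planck equation with the weighted integrability is a
Borel subset of `C([0,T],P(ℝ^d))` (compact-open topology, `P(ℝ^d)` with the narrow
topology). -/
theorem stmt13 {T : ℝ} {d : ℕ} (hT : 0 ≤ T)
    (b : ℝ → Ed d → Pm d → Ed d)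
    (a : ℝ → Ed d → Pm d → (Ed d →L[ℝ] Ed d))
    (hb : Measurable fun p : ℝ × Ed d × Pm d => b p.1 p.2.1 p.2.2)
    (ha : Measurable fun p : ℝ × Ed d × Pm d => a p.1 p.2.1 p.2.2) :
    MeasurableSet[borel (CurveSp T d)] {c : CurveSp T d | KFPmem hT b a c} := by
  choose D hD hD' using fun n => exists_countable_testPair hT n hb ha
  have hset : {c : CurveSp T d | KFPmem hT b a c} =
      {c | FiniteWeight hT b a c} ∩
        ⋂ n, ⋂ p ∈ D n, {c | SolvesTested hT b a p.1.1 p.1.2 c} := by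
    ext c
    simp only [mem_inter_iff, mem_iInter, mem_ofPred_eq]
    refine ⟨fun h => ⟨h.1, fun n p _ => h.2 _ _ p.2.1 p.2.2.1⟩, fun h => ⟨h.1, ?_⟩⟩
    intro ξ φ hξ hφ
    obtain ⟨r, hr⟩ := hφ.2.isCompact.isBounded.subset_closedBall 0
    obtain ⟨n, hn⟩ := exists_nat_ge r
    exact hD' n c h.1 (h.2 n)
      ⟨(ξ, φ), hξ, hφ, hr.trans (Metric.closedBall_subset_closedBall hn)⟩
  rw [hset]
  exact (measurableSet_finiteWeight hT hb ha).inter <| .iInter fun n =>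
    .biInter (hD n) fun p _ => measurableSet_solvesTested hT hb ha p.2.1 p.2.2.1
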